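/- Let (X,d) be a compact metric space, f : X → X a continuous map, and C a chain component of f. Then f|_C : C → C is chain continuous if and only if f|_C is an equicontinuous homeomorphism of C and C is totally disconnected. -/

import Mathlib

open Filter Topology Set

section Defs

variable {X : Type*} [MetricSpace X]

/-- `c 0, c 1, ..., c k` is a `δ`-chain of `f`. -/
def IsDeltaChain (f : X → X) (δ : ℝ) (c : ℕ → X) (k : ℕ) : Prop :=
  ∀ i < k, dist (f (c i)) (c (i + 1)) ≤ δ

/-- `x → y` : for every `δ > 0` there is a `δ`-chain of `f` from `x` to `y`. -/
def ChainReach (f : X → X) (x y : X) : Prop :=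
  ∀ δ > 0, ∃ (c : ℕ → X) (k : ℕ), 1 ≤ k ∧ IsDeltaChain f δ c k ∧ c 0 = x ∧ c k = y

/-- `C(x) = {x} ∪ {y : x → y}`. -/
def CSet (f : X → X) (x : X) : Set X := {x} ∪ {y | ChainReach f x y}

/-- The chain recurrent set. -/
def CR (f : X → X) : Set X := {x | ChainReach f x x}

/-- `C` is a chain component of `f` : an equivalence class of `↔` on `CR f`. -/
def IsChainComponent (f : X → X) (C : Set X) : Prop :=
  ∃ x ∈ CR f, C = {y ∈ CR f | ChainReach f x y ∧ ChainReach f y x}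

/-- A set `S` is chain stable for `f`. -/
def ChainStable (f : X → X) (S : Set X) : Prop :=
  ∀ ε > 0, ∃ δ > 0, ∀ (c : ℕ → X) (k : ℕ), 1 ≤ k → IsDeltaChain f δ c k → c 0 ∈ S →
    ∀ i ≤ k, Metric.infDist (c i) S ≤ ε

/-- `ξ` is a `δ`-pseudo orbit of `f`. -/
def IsPseudoOrbit (f : X → X) (δ : ℝ) (ξ : ℕ → X) : Prop :=
  ∀ i, dist (f (ξ i)) (ξ (i + 1)) ≤ δ

/-- `x` is a shadowable point of `f`. -/
def ShadowablePt (f : X → X) (x : X) : Prop :=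
  ∀ ε > 0, ∃ δ > 0, ∀ ξ : ℕ → X, IsPseudoOrbit f δ ξ → ξ 0 = x →
    ∃ y, ∀ i, dist (f^[i] y) (ξ i) ≤ ε

/-- `f` has the shadowing on `S`. -/
def ShadowingOn (f : X → X) (S : Set X) : Prop :=
  ∀ ε > 0, ∃ δ > 0, ∀ ξ : ℕ → X, IsPseudoOrbit f δ ξ → (∀ i, ξ i ∈ S) →
    ∃ y, ∀ i, dist (f^[i] y) (ξ i) ≤ ε

/-- `f` has the shadowing property. -/
def ShadowingProperty (f : X → X) : Prop :=
  ∀ ε > 0, ∃ δ > 0, ∀ ξ : ℕ → X, IsPseudoOrbit f δ ξ →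
    ∃ y, ∀ i, dist (f^[i] y) (ξ i) ≤ ε

/-- `f` is chain transitive. -/
def ChainTransitive (f : X → X) : Prop := ∀ x y : X, ChainReach f x y

/-- `f` restricted to `S` is chain continuous. -/
def ChainContinuousOn (f : X → X) (S : Set X) : Prop :=
  ∀ ε > 0, ∃ δ > 0, ∀ ξ η : ℕ → X, IsPseudoOrbit f δ ξ → IsPseudoOrbit f δ η →
    (∀ i, ξ i ∈ S) → (∀ i, η i ∈ S) → ξ 0 = η 0 → ∀ i, dist (ξ i) (η i) ≤ ε

/-- `f` restricted to `S` is equicontinuous. -/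
def EquicontinuousOnSet (f : X → X) (S : Set X) : Prop :=
  ∀ ε > 0, ∃ δ > 0, ∀ x ∈ S, ∀ y ∈ S, dist x y ≤ δ → ∀ i : ℕ, dist (f^[i] x) (f^[i] y) ≤ ε

/-- `s_n(f,K,r)` : largest cardinality of an `(n,r)`-separated subset of `K`. -/
noncomputable def sepNum (f : X → X) (K : Set X) (n : ℕ) (r : ℝ) : ℕ :=
  sSup {m | ∃ E : Finset X, (E : Set X) ⊆ K ∧
    (∀ x ∈ E, ∀ y ∈ E, x ≠ y → ∃ i < n, r < dist (f^[i] x) (f^[i] y)) ∧ E.card = m}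

/-- `h(f,K,r) = limsup (1/n) log s_n(f,K,r)`. -/
noncomputable def entH (f : X → X) (K : Set X) (r : ℝ) : EReal :=
  Filter.limsup (fun n : ℕ => ((Real.log (sepNum f K n r) / n : ℝ) : EReal)) Filter.atTop

/-- `h(f,K) = lim_{r → 0} h(f,K,r) = sup_{r > 0} h(f,K,r)`. -/
noncomputable def ent (f : X → X) (K : Set X) : EReal :=
  ⨆ r ∈ Set.Ioi (0 : ℝ), entH f K r

/-- `Ent_r(f)`. -/
def EntR (f : X → X) (r : ℝ) : Set X :=
  {x | ∀ K : Set X, IsClosed K → K ∈ 𝓝 x → 0 < entH f K r}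

/-- `Ent_{r,b}(f)`. -/
def EntRB (f : X → X) (r b : ℝ) : Set X :=
  {x | ∀ K : Set X, IsClosed K → K ∈ 𝓝 x → (b : EReal) ≤ entH f K r}

/-- The ω-limit set of `x` under `f`. -/
def omegaLim (f : X → X) (x : X) : Set X :=
  {y | ∃ φ : ℕ → ℕ, StrictMono φ ∧ Tendsto (fun j => f^[φ j] x) atTop (𝓝 y)}

/-- The set of `e`-sensitive points of `f` restricted to `S`. -/
def SenE (f : X → X) (S : Set X) (e : ℝ) : Set X :=
  {x ∈ S | ∀ ε > 0, ∃ y ∈ S, dist x y ≤ ε ∧ ∃ i : ℕ, e < dist (f^[i] x) (f^[i] y)}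

/-- `Sen(f|_S) = ⋃_{e > 0} Sen_e(f|_S)`. -/
def Sen (f : X → X) (S : Set X) : Set X := ⋃ e ∈ Set.Ioi (0 : ℝ), SenE f S e

/-- `(x,y)` is a scrambled pair for `f`. -/
def ScrambledPair (f : X → X) (x y : X) : Prop :=
  0 < Filter.limsup (fun i : ℕ => dist (f^[i] x) (f^[i] y)) Filter.atTop ∧
    Filter.liminf (fun i : ℕ => dist (f^[i] x) (f^[i] y)) Filter.atTop = 0

/-- `M` is a minimal set for `f`. -/
def IsMinimalSet (f : X → X) (M : Set X) : Prop :=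
  IsClosed M ∧ MapsTo f M M ∧ ∀ S ⊆ M, IsClosed S → MapsTo f S S → S = ∅ ∨ S = M

/-- `Φ_ε(x)`. -/
def Phi (f : X → X) (ε : ℝ) (x : X) : Set X :=
  {y | ∀ i : ℕ, dist (f^[i] x) (f^[i] y) ≤ ε}

/-- `h*_f(ε) = sup_x h(f,Φ_ε(x))`. -/
noncomputable def hStar (f : X → X) (ε : ℝ) : EReal := ⨆ x : X, ent f (Phi f ε x)

/-- `f` is h-expansive. -/
def HExpansive (f : X → X) : Prop := ∃ ε > 0, hStar f ε = 0

end Defs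

open Relation

section Chains

variable {X : Type*} [MetricSpace X] {f : X → X} {C : Set X}

/-- `b` is within `δ` of `f a`. -/
def PseudoStep (f : X → X) (δ : ℝ) (a b : X) : Prop := dist (f a) b ≤ δ

lemma PseudoStep.mono {δ δ' : ℝ} (h : δ ≤ δ') (a b : X) (hab : PseudoStep f δ a b) :
    PseudoStep f δ' a b := le_trans hab h

lemma exists_chain_of_transGen {α : Type*} {r : α → α → Prop} {x y : α} (h : TransGen r x y) :
    ∃ (c : ℕ → α) (k : ℕ), 1 ≤ k ∧ (∀ i < k, r (c i) (c (i + 1))) ∧ c 0 = x ∧ c k = y := by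
  induction h with
  | @single y h =>
    refine ⟨fun i => if i = 0 then x else y, 1, le_rfl, ?_, by simp, by simp⟩
    intro i hi
    obtain rfl : i = 0 := by omega
    simpa using h
  | @tail b z _ hbz ih =>
    obtain ⟨c, k, hk, hc, h0, hck⟩ := ih
    refine ⟨fun i => if i ≤ k then c i else z, k + 1, by omega, ?_, by simpa using h0, by simp⟩
    intro i hi
    rcases Nat.lt_or_ge i k with h | h
    · have h1 : i ≤ k := h.le
      have h2 : i + 1 ≤ k := h
      simpa [h1, h2] using hc i h
    · obtain rfl : i = k := by omega
      simpa [hck] using hbz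

lemma transGen_of_chain {α : Type*} {r : α → α → Prop} {c : ℕ → α} {k : ℕ} (hk : 1 ≤ k)
    (hc : ∀ i < k, r (c i) (c (i + 1))) : TransGen r (c 0) (c k) := by
  induction k, hk using Nat.le_induction with
  | base => exact .single (hc 0 one_pos)
  | succ k _ ih => exact (ih fun i hi => hc i (by omega)).tail (hc k (by omega))

lemma chainReach_iff_transGen {x y : X} :
    ChainReach f x y ↔ ∀ δ > 0, TransGen (PseudoStep f δ) x y := by
  refine forall₂_congr fun δ _ => ⟨?_, exists_chain_of_transGen⟩
  rintro ⟨c, k, hk, hc, rfl, rfl⟩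
  exact transGen_of_chain hk hc

lemma ChainReach.trans {x y z : X} (h₁ : ChainReach f x y) (h₂ : ChainReach f y z) :
    ChainReach f x z := by
  rw [chainReach_iff_transGen] at *
  exact fun δ hδ => (h₁ δ hδ).trans (h₂ δ hδ)

lemma transGen_pseudoStep_of_dist_right {x p q : X} {δ : ℝ}
    (h : TransGen (PseudoStep f (δ / 2)) x q) (hδ : 0 ≤ δ) (hqp : dist q p ≤ δ / 2) :
    TransGen (PseudoStep f δ) x p := by
  obtain ⟨b, hxb, hbq⟩ := TransGen.tail'_iff.1 h
  refine TransGen.tail' (ReflTransGen.mono (PseudoStep.mono (by linarith)) _ _ hxb) ?_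
  have := dist_triangle (f b) q p
  unfold PseudoStep at *
  linarith

lemma transGen_pseudoStep_of_dist_left {x p q : X} {δ : ℝ}
    (h : TransGen (PseudoStep f (δ / 2)) q x) (hδ : 0 ≤ δ) (hpq : dist (f p) (f q) ≤ δ / 2) :
    TransGen (PseudoStep f δ) p x := by
  obtain ⟨b, hqb, hbx⟩ := TransGen.head'_iff.1 h
  refine TransGen.head' ?_ (ReflTransGen.mono (PseudoStep.mono (by linarith)) _ _ hbx)
  have := dist_triangle (f p) (f q) b
  unfold PseudoStep at *
  linarith

lemma IsChainComponent.mem_iff (hC : IsChainComponent f C) {z : X} (hz : z ∈ C) (y : X) :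
    y ∈ C ↔ ChainReach f z y ∧ ChainReach f y z := by
  obtain ⟨x, -, rfl⟩ := hC
  obtain ⟨-, hxz, hzx⟩ := hz
  constructor
  · rintro ⟨-, hxy, hyx⟩
    exact ⟨hzx.trans hxy, hyx.trans hxz⟩
  · rintro ⟨hzy, hyz⟩
    exact ⟨hyz.trans hzy, hxz.trans hzy, hyz.trans hzx⟩

lemma IsChainComponent.nonempty (hC : IsChainComponent f C) : C.Nonempty := by
  obtain ⟨x, hx, rfl⟩ := hC
  exact ⟨x, hx, hx, hx⟩

lemma IsChainComponent.exists_eventually_not_transGen (hC : IsChainComponent f C)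
    (hf : Continuous f) {z y : X} (hz : z ∈ C) (hy : y ∉ C) :
    ∃ δ > 0, ∀ᶠ q in 𝓝 y,
      ¬ (TransGen (PseudoStep f δ) z q ∧ TransGen (PseudoStep f δ) q z) := by
  rw [hC.mem_iff hz, chainReach_iff_transGen, chainReach_iff_transGen, not_and_or] at hy
  push Not at hy
  rcases hy with ⟨δ, hδ, h⟩ | ⟨δ, hδ, h⟩
  · refine ⟨δ / 2, by positivity, ?_⟩
    filter_upwards [Metric.closedBall_mem_nhds y (half_pos hδ)] with q hq hzq
    exact h (transGen_pseudoStep_of_dist_right hzq.1 hδ.le hq)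
  · refine ⟨δ / 2, by positivity, ?_⟩
    filter_upwards [hf.continuousAt (Metric.closedBall_mem_nhds (f y) (half_pos hδ))] with q hq hqz
    refine h (transGen_pseudoStep_of_dist_left hqz.2 hδ.le ?_)
    rw [dist_comm]
    exact hq

lemma IsChainComponent.isClosed (hC : IsChainComponent f C) (hf : Continuous f) : IsClosed C := by
  obtain ⟨z, hz⟩ := hC.nonempty
  rw [← isOpen_compl_iff, isOpen_iff_eventually]
  intro y hy
  obtain ⟨δ, hδ, h⟩ := hC.exists_eventually_not_transGen hf hz hy
  filter_upwards [h] with q hq hqC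
  obtain ⟨h₁, h₂⟩ := (hC.mem_iff hz q).1 hqC
  exact hq ⟨chainReach_iff_transGen.1 h₁ δ hδ, chainReach_iff_transGen.1 h₂ δ hδ⟩

lemma IsChainComponent.mapsTo (hC : IsChainComponent f C) (hf : Continuous f) :
    MapsTo f C C := by
  intro y hy
  have hyy : ChainReach f y y := ((hC.mem_iff hy y).1 hy).1
  rw [hC.mem_iff hy, chainReach_iff_transGen, chainReach_iff_transGen]
  rw [chainReach_iff_transGen] at hyy
  refine ⟨fun δ hδ => .single (by simpa [PseudoStep] using hδ.le), fun δ hδ => ?_⟩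
  obtain ⟨η, hη, hηf⟩ := Metric.continuousAt_iff.1 (hf.continuousAt (x := f y)) (δ / 2)
    (half_pos hδ)
  obtain ⟨b, hyb, hby⟩ := TransGen.head'_iff.1 (hyy (min (δ / 2) (η / 2)) (by positivity))
  have hby' : TransGen (PseudoStep f (min (δ / 2) (η / 2))) b y :=
    TransGen.trans_right hby (hyy _ (by positivity))
  refine transGen_pseudoStep_of_dist_left
    (TransGen.mono (PseudoStep.mono (min_le_left _ _)) _ _ hby') hδ.le ?_
  rw [dist_comm]
  refine (hηf ?_).le
  rw [dist_comm]
  exact lt_of_le_of_lt (le_trans hyb (min_le_right _ _)) (half_lt_self hη)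

lemma TransGen.restrict_loop {α : Type*} {r : α → α → Prop} {x z : α} (hx : TransGen r x x)
    (hxz : TransGen r x z) (hzx : TransGen r z x) :
    TransGen (fun a b => r a b ∧ (TransGen r x a ∧ TransGen r a x) ∧
      (TransGen r x b ∧ TransGen r b x)) x z := by
  induction hxz with
  | single h => exact .single ⟨h, ⟨hx, hx⟩, .single h, hzx⟩
  | tail hb hbz ih =>
    have hbx := TransGen.head hbz hzx
    exact (ih hbx).tail ⟨hbz, ⟨hb, hbx⟩, hb.tail hbz, hzx⟩

variable [CompactSpace X]

lemma IsChainComponent.exists_forall_mem_thickening (hC : IsChainComponent f C) (hf : Continuous f)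
    {z : X} (hz : z ∈ C) {η : ℝ} (hη : 0 < η) :
    ∃ δ > 0, ∀ q, TransGen (PseudoStep f δ) z q → TransGen (PseudoStep f δ) q z →
      q ∈ Metric.thickening η C := by
  have hK : IsCompact (Metric.thickening η C)ᶜ := Metric.isOpen_thickening.isClosed_compl.isCompact
  obtain ⟨δ, hδ, h⟩ : ∃ δ > 0, ∀ q ∈ (Metric.thickening η C)ᶜ,
      ¬ (TransGen (PseudoStep f δ) z q ∧ TransGen (PseudoStep f δ) q z) := by
    refine hK.induction_on (p := fun s => ∃ δ > 0, ∀ q ∈ s,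
      ¬ (TransGen (PseudoStep f δ) z q ∧ TransGen (PseudoStep f δ) q z)) ?_ ?_ ?_ ?_
    · exact ⟨1, one_pos, by simp⟩
    · rintro s t hst ⟨δ, hδ, h⟩
      exact ⟨δ, hδ, fun q hq => h q (hst hq)⟩
    · rintro s t ⟨δ, hδ, h⟩ ⟨δ', hδ', h'⟩
      refine ⟨min δ δ', lt_min hδ hδ', ?_⟩
      rintro q (hq | hq) ⟨h₁, h₂⟩
      · exact h q hq ⟨TransGen.mono (PseudoStep.mono (min_le_left _ _)) _ _ h₁,
          TransGen.mono (PseudoStep.mono (min_le_left _ _)) _ _ h₂⟩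
      · exact h' q hq ⟨TransGen.mono (PseudoStep.mono (min_le_right _ _)) _ _ h₁,
          TransGen.mono (PseudoStep.mono (min_le_right _ _)) _ _ h₂⟩
    · intro y hy
      have hyC : y ∉ C := fun h => hy (Metric.self_subset_thickening hη C h)
      obtain ⟨δ, hδ, h⟩ := hC.exists_eventually_not_transGen hf hz hyC
      exact ⟨_, mem_nhdsWithin_of_mem_nhds h, δ, hδ, fun q hq => hq⟩
  refine ⟨δ, hδ, fun q h₁ h₂ => ?_⟩
  by_contra hq
  exact h q hq ⟨h₁, h₂⟩

/-- Every point of a chain component returns to itself along chains inside the component. -/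
lemma IsChainComponent.transGen_self (hC : IsChainComponent f C) (hf : Continuous f)
    {z : X} (hz : z ∈ C) {δ : ℝ} (hδ : 0 < δ) :
    TransGen (fun a b => a ∈ C ∧ PseudoStep f δ a b) z z := by
  obtain ⟨η, hη, hηf⟩ := Metric.uniformContinuous_iff.1
    (CompactSpace.uniformContinuous_of_continuous hf) (δ / 3) (by positivity)
  obtain ⟨δ', hδ', h⟩ := hC.exists_forall_mem_thickening hf hz (η := min η (δ / 3)) (by positivity)
  have key : ∀ q, ∃ p, p ∈ C ∧ (q = z → p = z) ∧
      (q ∈ Metric.thickening (min η (δ / 3)) C → dist q p < min η (δ / 3)) := by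
    intro q
    by_cases hqz : q = z
    · subst hqz
      exact ⟨q, hz, fun _ => rfl, fun _ => by rw [dist_self]; positivity⟩
    by_cases hq : q ∈ Metric.thickening (min η (δ / 3)) C
    · obtain ⟨p, hp, hqp⟩ := Metric.mem_thickening_iff.1 hq
      exact ⟨p, hp, fun h => absurd h hqz, fun _ => hqp⟩
    · exact ⟨z, hz, fun _ => rfl, fun h => absurd h hq⟩
  choose π hπC hπz hπ using key
  have hzz := chainReach_iff_transGen.1 ((hC.mem_iff hz z).1 hz).1 (min δ' (δ / 3)) (by positivity)
  have := TransGen.lift (p := fun a b => a ∈ C ∧ PseudoStep f δ a b) π ?_ _ _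
    (TransGen.restrict_loop hzz hzz hzz)
  · simpa [Function.onFun, hπz z rfl] using this
  rintro a b ⟨hab, ⟨ha, ha'⟩, hb, hb'⟩
  have hm := PseudoStep.mono (f := f) (min_le_left δ' (δ / 3))
  have h₁ := hπ a (h a (TransGen.mono hm _ _ ha) (TransGen.mono hm _ _ ha'))
  have h₂ := hπ b (h b (TransGen.mono hm _ _ hb) (TransGen.mono hm _ _ hb'))
  refine ⟨hπC a, ?_⟩
  have h₃ := hηf (lt_of_lt_of_le h₁ (min_le_left _ _))
  have h₄ := lt_of_lt_of_le h₂ (min_le_right _ _)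
  have h₅ : dist (f a) b ≤ δ / 3 := le_trans hab (min_le_right _ _)
  have := dist_triangle4 (f (π a)) (f a) b (π b)
  rw [dist_comm] at h₃
  unfold PseudoStep
  linarith

end Chains

section ChainContinuity

variable {X : Type*} [MetricSpace X] {f : X → X} {C : Set X}

lemma isPseudoOrbit_iterate (f : X → X) {δ : ℝ} (hδ : 0 ≤ δ) (x : X) :
    IsPseudoOrbit f δ fun i => f^[i] x := fun i => by
  simpa [Function.iterate_succ_apply'] using hδ

/-- A loop of pseudo steps inside `C` unrolls to a periodic pseudo orbit. -/
lemma exists_isPseudoOrbit_of_transGen_self {δ : ℝ} {x : X}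
    (h : TransGen (fun a b => a ∈ C ∧ PseudoStep f δ a b) x x) :
    ∃ ξ : ℕ → X, ∃ k ≥ 1, IsPseudoOrbit f δ ξ ∧ (∀ i, ξ i ∈ C) ∧ ∀ j, ξ (k * j) = x := by
  obtain ⟨c, k, hk, hc, h0, hck⟩ := exists_chain_of_transGen h
  refine ⟨fun i => c (i % k), k, hk, fun i => ?_, fun i => (hc _ (Nat.mod_lt _ hk)).1,
    fun j => by simp [h0]⟩
  have hlt : i % k < k := Nat.mod_lt _ hk
  rcases Nat.lt_or_ge (i % k + 1) k with h | h
  · have : (i + 1) % k = i % k + 1 := by rw [← Nat.mod_add_mod, Nat.mod_eq_of_lt h]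
    simpa only [PseudoStep, this] using (hc _ hlt).2
  · have h1 : i % k + 1 = k := by omega
    have h2 : (i + 1) % k = 0 := by rw [← Nat.mod_add_mod, h1, Nat.mod_self]
    have h3 := (hc _ hlt).2
    rw [h1, hck, ← h0] at h3
    simpa only [PseudoStep, h2] using h3

lemma ChainContinuousOn.exists_dist_iterate_mul_le (h : ChainContinuousOn f C)
    (hmaps : MapsTo f C C) {x : X} (hx : x ∈ C)
    (hloop : ∀ δ > 0, TransGen (fun a b => a ∈ C ∧ PseudoStep f δ a b) x x)
    {ε : ℝ} (hε : 0 < ε) : ∃ k ≥ 1, ∀ j, dist (f^[k * j] x) x ≤ ε := by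
  obtain ⟨δ, hδ, hcc⟩ := h ε hε
  obtain ⟨ξ, k, hk, hξ, hξC, hξk⟩ := exists_isPseudoOrbit_of_transGen_self (hloop δ hδ)
  refine ⟨k, hk, fun j => ?_⟩
  have := hcc _ ξ (isPseudoOrbit_iterate f hδ.le x) hξ (fun i => hmaps.iterate i hx) hξC
    (by simpa using (hξk 0).symm) (k * j)
  rwa [hξk] at this

/-- Points whose orbits are asymptotic coincide. -/
lemma ChainContinuousOn.eq_of_asymptotic (h : ChainContinuousOn f C)
    (hmaps : MapsTo f C C)
    (hloop : ∀ x ∈ C, ∀ δ > 0, TransGen (fun a b => a ∈ C ∧ PseudoStep f δ a b) x x)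
    {x y : X} (hx : x ∈ C) (hy : y ∈ C)
    (hxy : ∀ ε > 0, ∃ N, ∀ n ≥ N, dist (f^[n] x) (f^[n] y) ≤ ε) : x = y := by
  refine eq_of_forall_dist_le fun ε hε => ?_
  have hε3 : 0 < ε / 3 := by positivity
  obtain ⟨k, hk, hkx⟩ := h.exists_dist_iterate_mul_le hmaps hx (hloop x hx) hε3
  obtain ⟨l, hl, hly⟩ := h.exists_dist_iterate_mul_le hmaps hy (hloop y hy) hε3
  obtain ⟨N, hN⟩ := hxy (ε / 3) hε3
  have h₁ := hkx (l * N)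
  have h₂ := hly (k * N)
  have e : l * (k * N) = k * (l * N) := by ring
  rw [e] at h₂
  have h₃ := hN (k * (l * N))
    (by rw [← mul_assoc]; exact Nat.le_mul_of_pos_left N (Nat.mul_pos hk hl))
  have := dist_triangle4 x (f^[k * (l * N)] x) (f^[k * (l * N)] y) y
  rw [dist_comm] at h₁
  linarith

lemma ChainContinuousOn.equicontinuousOnSet (h : ChainContinuousOn f C)
    (hf : UniformContinuous f) (hmaps : MapsTo f C C) : EquicontinuousOnSet f C := by
  intro ε hε
  obtain ⟨δ, hδ, hcc⟩ := h ε hε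
  obtain ⟨η, hη, hηf⟩ := Metric.uniformContinuous_iff.1 hf δ hδ
  refine ⟨min ε (η / 2), by positivity, fun x hx y hy hxy i => ?_⟩
  rcases i with _ | i
  · exact hxy.trans (min_le_left _ _)
  have hd : dist (f x) (f y) ≤ δ :=
    (hηf (lt_of_le_of_lt (hxy.trans (min_le_right _ _)) (half_lt_self hη))).le
  have := hcc (fun i => f^[i] x) (fun i => if i = 0 then x else f^[i] y)
    (isPseudoOrbit_iterate f hδ.le x) ?_ (fun i => hmaps.iterate i hx) ?_ (by simp) (i + 1)
  · simpa using this
  · rintro (_ | i)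
    · simpa using hd
    · simpa [Function.iterate_succ_apply'] using hδ.le
  · rintro (_ | i)
    · simpa using hx
    · simpa using hmaps.iterate (i + 1) hy

/-- Chains of orbitwise close points yield a pseudo orbit joining the orbits of the endpoints. -/
lemma exists_isPseudoOrbit_of_reflTransGen (hmaps : MapsTo f C C) {δ : ℝ} (hδ : 0 ≤ δ) {x y : X}
    (hx : x ∈ C)
    (h : ReflTransGen (fun a b => b ∈ C ∧ ∀ i, dist (f^[i] a) (f^[i] b) ≤ δ) x y) :
    ∃ ξ : ℕ → X, ∃ N, IsPseudoOrbit f δ ξ ∧ (∀ i, ξ i ∈ C) ∧ ξ 0 = x ∧ ∀ n ≥ N, ξ n = f^[n] y := by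
  induction h with
  | refl => exact ⟨fun i => f^[i] x, 0, isPseudoOrbit_iterate f hδ x,
      fun i => hmaps.iterate i hx, rfl, fun _ _ => rfl⟩
  | @tail b c _ hbc ih =>
    obtain ⟨ξ, N, hξ, hξC, h0, hN⟩ := ih
    refine ⟨fun i => if i ≤ N then ξ i else f^[i] c, N + 1, fun i => ?_, fun i => ?_,
      by simpa using h0, fun n hn => ?_⟩
    · rcases lt_trichotomy i N with h | rfl | h
      · have h1 : i ≤ N := h.le
        have h2 : i + 1 ≤ N := h
        simpa [h1, h2] using hξ i
      · simpa [hN i le_rfl, ← Function.iterate_succ_apply' f] using hbc.2 (i + 1)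
      · have h1 : ¬ i ≤ N := by omega
        have h2 : ¬ i + 1 ≤ N := by omega
        simpa [h1, h2, Function.iterate_succ_apply'] using hδ
    · dsimp only
      split_ifs
      · exact hξC i
      · exact hmaps.iterate i hbc.1
    · have h1 : ¬ n ≤ N := by omega
      simp [h1]

lemma IsPreconnected.reflTransGen_dist_le {A : Set X} (hA : IsPreconnected A) {x y : X}
    (hx : x ∈ A) (hy : y ∈ A) {η : ℝ} (hη : 0 < η) :
    ReflTransGen (fun a b => (a ∈ A ∧ b ∈ A) ∧ dist a b ≤ η) x y := by
  refine hA.induction₂ _ (fun a ha => ?_) (fun a b c _ _ _ hab hbc => hab.trans hbc)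
    (fun a b _ _ hab => ?_) hx hy
  · filter_upwards [mem_nhdsWithin_of_mem_nhds (Metric.closedBall_mem_nhds a hη),
      self_mem_nhdsWithin] with b hb hbA
    exact .single ⟨⟨ha, hbA⟩, by rw [dist_comm]; exact hb⟩
  · have : Std.Symm fun a b => (a ∈ A ∧ b ∈ A) ∧ dist a b ≤ η :=
      ⟨fun a b h => ⟨h.1.symm, by rw [dist_comm]; exact h.2⟩⟩
    exact ReflTransGen.stdSymm.symm _ _ hab

lemma ChainContinuousOn.isTotallyDisconnected (h : ChainContinuousOn f C)
    (heq : EquicontinuousOnSet f C) (hmaps : MapsTo f C C)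
    (hloop : ∀ x ∈ C, ∀ δ > 0, TransGen (fun a b => a ∈ C ∧ PseudoStep f δ a b) x x) :
    IsTotallyDisconnected C := by
  intro A hAC hA x hx y hy
  refine h.eq_of_asymptotic hmaps hloop (hAC hx) (hAC hy) fun ε hε => ?_
  obtain ⟨δ, hδ, hcc⟩ := h ε hε
  obtain ⟨η, hη, hηf⟩ := heq δ hδ
  obtain ⟨ξ, N, hξ, hξC, h0, hN⟩ := exists_isPseudoOrbit_of_reflTransGen hmaps hδ.le (hAC hx)
    (ReflTransGen.mono (fun a b hab =>
      ⟨hAC hab.1.2, hηf a (hAC hab.1.1) b (hAC hab.1.2) hab.2⟩) _ _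
      (hA.reflTransGen_dist_le hx hy hη))
  refine ⟨N, fun n hn => ?_⟩
  rw [← hN n hn]
  exact hcc _ ξ (isPseudoOrbit_iterate f hδ.le x) hξ (fun i => hmaps.iterate i (hAC hx)) hξC
    h0.symm n

lemma ChainContinuousOn.bijOn (h : ChainContinuousOn f C) (hf : Continuous f) (hC : IsCompact C)
    (hmaps : MapsTo f C C)
    (hloop : ∀ x ∈ C, ∀ δ > 0, TransGen (fun a b => a ∈ C ∧ PseudoStep f δ a b) x x) :
    BijOn f C C := by
  refine ⟨hmaps, fun x hx y hy hxy => ?_, fun x hx => ?_⟩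
  · refine h.eq_of_asymptotic hmaps hloop hx hy fun ε hε => ⟨1, fun n hn => ?_⟩
    obtain ⟨m, rfl⟩ := Nat.exists_eq_add_of_le' hn
    simpa [hxy] using hε.le
  · rw [← (hC.image hf).isClosed.closure_eq, Metric.mem_closure_iff]
    intro ε hε
    obtain ⟨k, hk, hkx⟩ := h.exists_dist_iterate_mul_le hmaps hx (hloop x hx) (half_pos hε)
    obtain ⟨m, rfl⟩ := Nat.exists_eq_add_of_le' hk
    refine ⟨f (f^[m] x), mem_image_of_mem f (hmaps.iterate m hx), ?_⟩
    have := hkx 1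
    rw [mul_one, Function.iterate_succ_apply', dist_comm] at this
    linarith

/-- In a compact totally disconnected metric space, fine enough chains stay near their start. -/
lemma exists_forall_reflTransGen_dist_le (K : Type*) [MetricSpace K] [CompactSpace K]
    [TotallyDisconnectedSpace K] {ε : ℝ} (hε : 0 < ε) :
    ∃ δ > 0, ∀ x y : K, ReflTransGen (fun a b => dist a b ≤ δ) x y → dist x y ≤ ε := by
  obtain ⟨δ, hδ, h⟩ : ∃ δ > 0, ∀ x ∈ (univ : Set K), ∀ y,
      ReflTransGen (fun a b => dist a b ≤ δ) x y → dist x y ≤ ε := by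
    refine isCompact_univ.induction_on (p := fun s => ∃ δ > 0, ∀ x ∈ s, ∀ y : K,
      ReflTransGen (fun a b => dist a b ≤ δ) x y → dist x y ≤ ε) ?_ ?_ ?_ ?_
    · exact ⟨1, one_pos, by simp⟩
    · rintro s t hst ⟨δ, hδ, h⟩
      exact ⟨δ, hδ, fun q hq => h q (hst hq)⟩
    · rintro s t ⟨δ, hδ, h⟩ ⟨δ', hδ', h'⟩
      refine ⟨min δ δ', lt_min hδ hδ', ?_⟩
      rintro x (hx | hx) y hxy
      · exact h x hx y (ReflTransGen.mono (fun a b hab => hab.trans (min_le_left _ _)) _ _ hxy)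
      · exact h' x hx y (ReflTransGen.mono (fun a b hab => hab.trans (min_le_right _ _)) _ _ hxy)
    · intro z _
      obtain ⟨U, hU, hzU, hUz⟩ := compact_exists_isClopen_in_isOpen
        (Metric.isOpen_ball (x := z) (ε := ε / 2)) (Metric.mem_ball_self (half_pos hε))
      obtain ⟨δ, hδ, hδU⟩ := hU.isClosed.isCompact.exists_cthickening_subset_open hU.isOpen
        subset_rfl
      refine ⟨U, mem_nhdsWithin_of_mem_nhds (hU.isOpen.mem_nhds hzU), δ, hδ, fun x hx y hxy => ?_⟩
      have hy : y ∈ U := by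
        induction hxy with
        | refl => exact hx
        | @tail b c _ hbc ih =>
          exact hδU (Metric.mem_cthickening_of_dist_le c b δ U ih (by rwa [dist_comm]))
      have h₁ := Metric.mem_ball.1 (hUz hx)
      have h₂ := Metric.mem_ball.1 (hUz hy)
      have := dist_triangle_right x y z
      linarith
  exact ⟨δ, hδ, fun x => h x (mem_univ x)⟩

lemma EquicontinuousOnSet.chainContinuousOn (h : EquicontinuousOnSet f C) (hC : IsCompact C)
    (hmaps : MapsTo f C C) (htd : IsTotallyDisconnected C) : ChainContinuousOn f C := by
  intro ε hε
  have : CompactSpace C := isCompact_iff_compactSpace.1 hC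
  have : TotallyDisconnectedSpace C := totallyDisconnectedSpace_subtype_iff.2 htd
  obtain ⟨δ, hδ, hch⟩ := exists_forall_reflTransGen_dist_le C (half_pos hε)
  obtain ⟨η, hη, hηf⟩ := h δ hδ
  set g : C → C := hmaps.restrict f C C with hg
  let r : C → C → Prop := fun a b => ∀ i, dist (f^[i] a) (f^[i] b) ≤ δ
  have hrg : ∀ a b, r a b → r (g a) (g b) := fun a b hab i => hab (i + 1)
  have key : ∀ ξ : ℕ → X, IsPseudoOrbit f η ξ → (∀ i, ξ i ∈ C) →
      ∀ i, dist (f^[i] (ξ 0)) (ξ i) ≤ ε / 2 := by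
    intro ξ hξ hξC i
    have hr : ∀ i, ReflTransGen r ⟨f^[i] (ξ 0), hmaps.iterate i (hξC 0)⟩ ⟨ξ i, hξC i⟩ := by
      intro i
      induction i with
      | zero => exact .refl
      | succ i ih =>
        have := (ReflTransGen.lift (p := r) g hrg _ _ ih).tail (c := ⟨ξ (i + 1), hξC (i + 1)⟩)
          (hηf _ (hmaps (hξC i)) _ (hξC (i + 1)) (hξ i))
        simpa [Function.onFun, hg, MapsTo.restrict, Subtype.map,
          Function.iterate_succ_apply'] using this
    exact hch _ _ (ReflTransGen.mono (fun a b hab => hab 0) _ _ (hr i))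
  refine ⟨η, hη, fun ξ ζ hξ hζ hξC hζC h0 i => ?_⟩
  have h₁ := key ξ hξ hξC i
  have h₂ := key ζ hζ hζC i
  rw [← h0] at h₂
  have := dist_triangle_left (ξ i) (ζ i) (f^[i] (ξ 0))
  linarith

end ChainContinuity

/-- Corollary 2.1 ((2) ↔ (3)): for a chain component `C`, `f|_C` is chain continuous
iff `f|_C` is an equicontinuous homeomorphism of `C` and `C` is totally disconnected. -/
theorem stmt_9 {X : Type*} [MetricSpace X] [CompactSpace X] (f : X → X)
    (hf : Continuous f) (C : Set X) (hC : IsChainComponent f C) :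
    ChainContinuousOn f C ↔
      (Set.BijOn f C C ∧ EquicontinuousOnSet f C ∧ IsTotallyDisconnected C) := by
  have hmaps := hC.mapsTo hf
  have hcomp := (hC.isClosed hf).isCompact
  have hloop := fun x (hx : x ∈ C) δ (hδ : δ > 0) => hC.transGen_self hf hx hδ
  constructor
  · intro h
    have heq := h.equicontinuousOnSet (CompactSpace.uniformContinuous_of_continuous hf) hmaps
    exact ⟨h.bijOn hf hcomp hmaps hloop, heq, h.isTotallyDisconnected heq hmaps hloop⟩
  · rintro ⟨-, heq, htd⟩
    exact heq.chainContinuousOn hcomp hmaps htd
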